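/- arXiv:2212.11374 — 4 statements merged into one kernel-verified Lean document; each statement's English description precedes it below -/
import Mathlib

section
/- Let R be a commutative Noetherian ring of prime characteristic p, let J ⊆ R be an ideal, and let ρ be a Frobenius action on an R-module M. Assume there exists e₀ ∈ ℕ such that ρ^{e₀}(m) = 0 for every ρ-nilpotent element m ∈ M (i.e., the Hartshorne–Speiser–Lyubeznik number of (M, ρ) is at most e₀). Then the following are equivalent: (a) there exists N ∈ ℕ such that every element of the submodule J^N • M is ρ-nilpotent; (b) there exists N ∈ ℕ such that for every x ∈ J^N, every e ≥ e₀, and every m ∈ M, one has x^{p^e} • ρ^e(m) = 0; (c) J is contained in the radical of the annihilator of M / 0^ρ_M, i.e., for every x ∈ J there exists k ∈ ℕ with x^k • M ⊆ 0^ρ_M. -/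
theorem iterate_smul_of_semilinear {R M : Type*} [CommRing R] [AddCommGroup M] [Module R M]
    {p : ℕ} {ρ : M → M} (hsemi : ∀ (r : R) (m : M), ρ (r • m) = r ^ p • ρ m)
    (e : ℕ) (r : R) (m : M) : ρ^[e] (r • m) = r ^ p ^ e • ρ^[e] m := by
  induction e with
  | zero => simp
  | succ e ih =>
    rw [Function.iterate_succ_apply', Function.iterate_succ_apply', ih, hsemi, ← pow_mul,
      ← pow_succ]

theorem iterate_eq_zero_of_le {M : Type*} [Zero M] {ρ : M → M} (h0 : ρ 0 = 0) {d e : ℕ}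
    (hde : d ≤ e) {m : M} (hm : ρ^[d] m = 0) : ρ^[e] m = 0 := by
  obtain ⟨k, rfl⟩ := Nat.exists_eq_add_of_le' hde
  rw [Function.iterate_add_apply, hm, Function.iterate_fixed h0]

/-- The submodule of nilpotent elements of a Frobenius action. -/
def frobeniusNilpotents {R M : Type*} [CommRing R] [AddCommGroup M] [Module R M]
    {p : ℕ} (ρ : M →+ M) (hsemi : ∀ (r : R) (m : M), ρ (r • m) = r ^ p • ρ m) :
    Submodule R M where
  carrier := {m | ∃ e : ℕ, ρ^[e] m = 0}
  zero_mem' := ⟨0, rfl⟩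
  add_mem' := by
    rintro a b ⟨d, hd⟩ ⟨e, he⟩
    refine ⟨max d e, ?_⟩
    rw [iterate_map_add, iterate_eq_zero_of_le (map_zero ρ) (le_max_left d e) hd,
      iterate_eq_zero_of_le (map_zero ρ) (le_max_right d e) he, add_zero]
  smul_mem' := by
    rintro r m ⟨e, he⟩
    exact ⟨e, by rw [iterate_smul_of_semilinear hsemi, he, smul_zero]⟩

/-- Equivalent conditions for `J^N • M` to be nilpotent, for a module with a Frobenius
action whose Hartshorne–Speiser–Lyubeznik number is at most `e₀`. -/
theorem equivalent_conditions_nilpotent_JNM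
    {R : Type*} [CommRing R] [IsNoetherianRing R]
    (p : ℕ) (hp : p.Prime) (hchar : (p : R) = 0)
    {M : Type*} [AddCommGroup M] [Module R M]
    (ρ : M → M)
    (hadd : ∀ m m' : M, ρ (m + m') = ρ m + ρ m')
    (hsemi : ∀ (r : R) (m : M), ρ (r • m) = r ^ p • ρ m)
    (J : Ideal R)
    (e₀ : ℕ) (hHSL : ∀ m : M, (∃ e : ℕ, ρ^[e] m = 0) → ρ^[e₀] m = 0) :
    ((∃ N : ℕ, ∀ m ∈ (J ^ N • (⊤ : Submodule R M) : Submodule R M),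
        ∃ e : ℕ, ρ^[e] m = 0) ↔
      (∃ N : ℕ, ∀ x ∈ J ^ N, ∀ e : ℕ, e₀ ≤ e → ∀ m : M, x ^ (p ^ e) • ρ^[e] m = 0)) ∧
    ((∃ N : ℕ, ∀ m ∈ (J ^ N • (⊤ : Submodule R M) : Submodule R M),
        ∃ e : ℕ, ρ^[e] m = 0) ↔
      (∀ x ∈ J, ∃ k : ℕ, ∀ m : M, ∃ e : ℕ, ρ^[e] (x ^ k • m) = 0)) := by
  have h0 : ρ 0 = 0 := by simpa using hadd 0 0
  let K : Submodule R M := frobeniusNilpotents (AddMonoidHom.mk' ρ hadd) hsemi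
  have hK (N : ℕ) : (∀ m ∈ (J ^ N • (⊤ : Submodule R M) : Submodule R M),
      ∃ e : ℕ, ρ^[e] m = 0) ↔ ∀ x ∈ J ^ N, ∀ m : M, ∃ e : ℕ, ρ^[e] (x • m) = 0 := by
    refine ⟨fun h x hx m ↦ h _ (Submodule.smul_mem_smul hx trivial), fun h ↦ ?_⟩
    have hle : J ^ N • (⊤ : Submodule R M) ≤ K :=
      Submodule.smul_le.2 fun x hx m _ ↦ h x hx m
    exact fun m hm ↦ hle hm
  simp only [hK]
  refine ⟨⟨?_, ?_⟩, ?_, ?_⟩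
  · rintro ⟨N, h⟩
    refine ⟨N, fun x hx e he m ↦ ?_⟩
    rw [← iterate_smul_of_semilinear hsemi]
    exact iterate_eq_zero_of_le h0 he (hHSL _ (h x hx m))
  · rintro ⟨N, h⟩
    refine ⟨N, fun x hx m ↦ ⟨e₀, ?_⟩⟩
    rw [iterate_smul_of_semilinear hsemi]
    exact h x hx e₀ le_rfl m
  · rintro ⟨N, h⟩ x hx
    exact ⟨N, h _ (Ideal.pow_mem_pow hx N)⟩
  · intro h
    have hmem (x : R) : x ∈ Module.annihilator R (M ⧸ K) ↔ ∀ m : M, ∃ e : ℕ, ρ^[e] (x • m) = 0 := by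
      rw [Module.mem_annihilator, (Submodule.mkQ_surjective K).forall]
      refine forall_congr' fun m ↦ ?_
      rw [← map_smul, Submodule.mkQ_apply, Submodule.Quotient.mk_eq_zero]
      rfl
    have hrad : J ≤ (Module.annihilator R (M ⧸ K)).radical := fun x hx ↦
      (h x hx).imp fun k hk ↦ (hmem _).2 hk
    obtain ⟨N, hN⟩ := Ideal.exists_pow_le_of_le_radical_of_fg hrad (IsNoetherian.noetherian J)
    exact ⟨N, fun x hx ↦ (hmem x).1 (hN hx)⟩
end

section
/- Let ρ be a Frobenius action on an R-module M and let x ∈ R. Define ρ' : M → M by ρ'(m) = x^{p-1} • ρ(m). Then ρ' is again a Frobenius action on M, the submodule (0 :_M x) = {m ∈ M : x • m = 0} is ρ'-stable, and its ρ'-orbit closure equals the colon submodule of the ρ-nilpotent part: (0 :_M x)^{ρ'}_M = (0^ρ_M :_M x) = {m ∈ M : x • m is ρ-nilpotent}. -/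
/-- For `ρ' = x^(p-1) • ρ`, the map `ρ'` is again a Frobenius action, `(0 :_M x)` is
ρ'-stable, and its ρ'-orbit closure equals `(0^ρ_M :_M x)`. -/
theorem colon_orbit_closure
    {R : Type*} [CommRing R] (p : ℕ) (hp : p.Prime) (hchar : (p : R) = 0)
    {M : Type*} [AddCommGroup M] [Module R M]
    (ρ : M → M)
    (hadd : ∀ m m' : M, ρ (m + m') = ρ m + ρ m')
    (hsemi : ∀ (r : R) (m : M), ρ (r • m) = r ^ p • ρ m)
    (x : R) :
    (∀ m m' : M, (x ^ (p - 1) • ρ (m + m')) = x ^ (p - 1) • ρ m + x ^ (p - 1) • ρ m') ∧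
    (∀ (r : R) (m : M), x ^ (p - 1) • ρ (r • m) = r ^ p • (x ^ (p - 1) • ρ m)) ∧
    (∀ m : M, x • m = 0 → x • (x ^ (p - 1) • ρ m) = 0) ∧
    ({m : M | ∃ e : ℕ, x • ((fun m' : M => x ^ (p - 1) • ρ m')^[e] m) = 0} =
      {m : M | ∃ e : ℕ, ρ^[e] (x • m) = 0}) := by
  have key : Function.Semiconj (fun m : M => x • m) (fun m => x ^ (p - 1) • ρ m) ρ := fun m => by
    simp only [hsemi, smul_smul, mul_pow_sub_one hp.ne_zero]
  refine ⟨fun m m' => by rw [hadd, smul_add], fun r m => by rw [hsemi, smul_comm],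
    fun m hm => ?_, ?_⟩
  · have h0 : ρ 0 = 0 := by simpa using hadd 0 0
    simpa [hm, h0] using key m
  · ext m
    exact exists_congr fun e => by rw [← (key.iterate_right e).eq m]
end

section
/- Let M be an R-module equipped with an internal direct sum decomposition M = ⊕_{n ∈ ℤ} M_n into R-submodules, and let ρ be a graded Frobenius action on M, i.e., a Frobenius action satisfying ρ(M_n) ⊆ M_{n·p} for all n ∈ ℤ. Then the submodule 0^ρ_M of ρ-nilpotent elements is homogeneous: an element m ∈ M is ρ-nilpotent if and only if each homogeneous component of m is ρ-nilpotent. -/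
/-- An additive map sending degree `i` to degree `g i`, with `g` injective, commutes with taking
homogeneous components. -/
theorem DirectSum.coe_decompose_map_apply_of_injective {ι M σ : Type*} [DecidableEq ι]
    [AddCommMonoid M] [SetLike σ M] [AddSubmonoidClass σ M] (ℳ : ι → σ)
    [DirectSum.Decomposition ℳ] (f : M →+ M) {g : ι → ι} (hg : Function.Injective g)
    (hf : ∀ i, ∀ m ∈ ℳ i, f m ∈ ℳ (g i)) (m : M) (i : ι) :
    (DirectSum.decompose ℳ (f m) (g i) : M) = f (DirectSum.decompose ℳ m i) := by
  induction m using DirectSum.Decomposition.inductionOn ℳ with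
  | zero => simp
  | @homogeneous j x =>
    by_cases h : j = i
    · subst h
      rw [DirectSum.decompose_of_mem_same ℳ (hf _ _ x.2), DirectSum.decompose_of_mem_same ℳ x.2]
    · rw [DirectSum.decompose_of_mem_ne ℳ (hf _ _ x.2) (hg.ne h),
        DirectSum.decompose_of_mem_ne ℳ x.2 h, map_zero]
  | add a b ha hb => simp [DirectSum.decompose_add, ha, hb]

/-- The iterates of an additive map sending degree `i` to degree `g i`, with `g` injective, commute
with taking homogeneous components. -/
theorem DirectSum.coe_decompose_iterate_apply_of_injective {ι M σ : Type*} [DecidableEq ι]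
    [AddCommMonoid M] [SetLike σ M] [AddSubmonoidClass σ M] (ℳ : ι → σ)
    [DirectSum.Decomposition ℳ] (f : M →+ M) {g : ι → ι} (hg : Function.Injective g)
    (hf : ∀ i, ∀ m ∈ ℳ i, f m ∈ ℳ (g i)) (e : ℕ) (m : M) (i : ι) :
    (DirectSum.decompose ℳ (f^[e] m) (g^[e] i) : M) = f^[e] (DirectSum.decompose ℳ m i) := by
  induction e generalizing m i with
  | zero => rfl
  | succ e ih =>
    exact (ih (f m) (g i)).trans
      (congrArg f^[e] (DirectSum.coe_decompose_map_apply_of_injective ℳ f hg hf m i))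

/-- The elements of `M` killed by some iterate of an additive endomorphism. -/
def AddMonoidHom.nilpotentElements {M : Type*} [AddCommMonoid M] (f : M →+ M) :
    AddSubmonoid M where
  carrier := {m | ∃ e : ℕ, f^[e] m = 0}
  zero_mem' := ⟨0, rfl⟩
  add_mem' := by
    rintro a b ⟨d, hd⟩ ⟨e, he⟩
    refine ⟨d + e, ?_⟩
    rw [iterate_map_add, Function.iterate_add_apply f d e b, he, add_comm d e,
      Function.iterate_add_apply, hd, iterate_map_zero, iterate_map_zero, add_zero]

/-- For a graded Frobenius action on a ℤ-graded module, the submodule of nilpotent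
elements is homogeneous: `m` is ρ-nilpotent iff all its homogeneous components are. -/
theorem nilpotent_homogeneous
    {R : Type*} [CommRing R] (p : ℕ) (hp : p.Prime) (hchar : (p : R) = 0)
    {M : Type*} [AddCommGroup M] [Module R M]
    (ℳ : ℤ → Submodule R M) [DirectSum.Decomposition ℳ]
    (ρ : M → M)
    (hadd : ∀ m m' : M, ρ (m + m') = ρ m + ρ m')
    (hsemi : ∀ (r : R) (m : M), ρ (r • m) = r ^ p • ρ m)
    (hgraded : ∀ (n : ℤ), ∀ m ∈ ℳ n, ρ m ∈ ℳ (n * p)) :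
    ∀ m : M, (∃ e : ℕ, ρ^[e] m = 0) ↔
      ∀ n : ℤ, ∃ e : ℕ, ρ^[e] ((DirectSum.decompose ℳ m n : M)) = 0 := by
  intro m
  let f : M →+ M := AddMonoidHom.mk' ρ hadd
  have hg : Function.Injective fun n : ℤ => n * p :=
    mul_left_injective₀ (Nat.cast_ne_zero.mpr hp.ne_zero)
  constructor
  · rintro ⟨e, he⟩ n
    refine ⟨e, ?_⟩
    have h := DirectSum.coe_decompose_iterate_apply_of_injective ℳ f hg hgraded e m n
    change (DirectSum.decompose ℳ (ρ^[e] m) _ : M) = ρ^[e] _ at h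
    rw [← h, he, DirectSum.decompose_zero, DirectSum.zero_apply, ZeroMemClass.coe_zero]
  · intro h
    classical
    change m ∈ f.nilpotentElements
    rw [← DirectSum.sum_support_decompose ℳ m]
    exact sum_mem fun n _ => h n
end

section
/- Let R be a commutative Noetherian ring of prime characteristic p and let M be a finitely generated R-module with a Frobenius action ρ. Then the Hartshorne–Speiser–Lyubeznik number of (M, ρ) is finite: there exists e₀ ∈ ℕ such that ρ^{e₀}(m) = 0 for every ρ-nilpotent element m ∈ M, i.e., ρ^{e₀}(0^ρ_M) = 0. -/
/-- The kernel of the `e`-th iterate of an additive map that is semilinear over a power map. -/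
def iterateKer {R : Type*} [CommRing R] {M : Type*} [AddCommGroup M] [Module R M]
    (p : ℕ) (ρ : M → M)
    (hadd : ∀ m m' : M, ρ (m + m') = ρ m + ρ m')
    (hsemi : ∀ (r : R) (m : M), ρ (r • m) = r ^ p • ρ m) (e : ℕ) : Submodule R M where
  carrier := {m | ρ^[e] m = 0}
  zero_mem' := iterate_map_zero (AddMonoidHom.mk' ρ hadd) e
  add_mem' {a b} ha hb := by
    have h := iterate_map_add (AddMonoidHom.mk' ρ hadd) e a b
    simp_all
  smul_mem' r m hm := by
    have h : ∀ (e : ℕ) (r : R) (m : M), ρ^[e] (r • m) = r ^ p ^ e • ρ^[e] m := by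
      intro e
      induction e with
      | zero => simp
      | succ e ih =>
        intro r m
        rw [Function.iterate_succ_apply, Function.iterate_succ_apply, hsemi, ih, ← pow_mul,
          pow_succ']
    simp_all

/-- The Hartshorne–Speiser–Lyubeznik number of a finitely generated module with a
Frobenius action over a Noetherian ring is finite. -/
theorem HSL_finite
    {R : Type*} [CommRing R] [IsNoetherianRing R]
    (p : ℕ) (hp : p.Prime) (hchar : (p : R) = 0)
    {M : Type*} [AddCommGroup M] [Module R M] [Module.Finite R M]
    (ρ : M → M)
    (hadd : ∀ m m' : M, ρ (m + m') = ρ m + ρ m')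
    (hsemi : ∀ (r : R) (m : M), ρ (r • m) = r ^ p • ρ m) :
    ∃ e₀ : ℕ, ∀ m : M, (∃ e : ℕ, ρ^[e] m = 0) → ρ^[e₀] m = 0 := by
  have hmono : Monotone (iterateKer p ρ hadd hsemi) := by
    refine monotone_nat_of_le_succ fun e m (hm : ρ^[e] m = 0) => ?_
    change ρ^[e + 1] m = 0
    rw [Function.iterate_succ_apply', hm]
    exact map_zero (AddMonoidHom.mk' ρ hadd)
  obtain ⟨n, hn⟩ := monotone_stabilizes_iff_noetherian.mpr
    (inferInstance : IsNoetherian R M) ⟨_, hmono⟩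
  refine ⟨n, fun m ⟨e, he⟩ => ?_⟩
  have hm : m ∈ iterateKer p ρ hadd hsemi (max n e) := hmono (le_max_right n e) he
  have hn' : iterateKer p ρ hadd hsemi n = iterateKer p ρ hadd hsemi (max n e) :=
    hn _ (le_max_left n e)
  rw [← hn'] at hm
  exact hm
end
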